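/- Let (Ω, 𝔉, μ) be a probability space, T : Ω → Ω an ergodic μ-preserving transformation, and X : Ω → ℝⁿ measurable with σ({X∘T^k}_{k≥0}) equivalent to 𝔉 modulo μ-null sets. Then the Kolmogorov–Sinai entropy of T equals lim_{d→∞} lim_{k→∞} (1/k) H_μ((𝒫_d(X,T))^{(k)}), where 𝒫_d(X,T) is the ordinal partition of depth d and (·)^{(k)} denotes the join with the first k−1 preimages under T. -/

import Mathlib

open MeasureTheory Set Filter

variable {Ω : Type*} [MeasurableSpace Ω]

/-- The element of the ordinal partition `𝒫_d(X,T)` of a single observable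
`X : Ω → ℝ` corresponding to a permutation `π = (i₀,…,i_d)` of `{0,…,d}`
(ties broken by index). -/
def ordCell {Ω : Type*} (X : Ω → ℝ) (T : Ω → Ω) (d : ℕ)
    (π : Equiv.Perm (Fin (d + 1))) : Set Ω :=
  {ω | ∀ τ : Fin d,
    X (T^[(π τ.castSucc : ℕ)] ω) > X (T^[(π τ.succ : ℕ)] ω) ∨
    (X (T^[(π τ.castSucc : ℕ)] ω) = X (T^[(π τ.succ : ℕ)] ω) ∧
      (π τ.succ : ℕ) < (π τ.castSucc : ℕ))}

/-- The ordinal partition `𝒫_d(X,T) = ⋁_{i=1}^n 𝒫_d(X_i,T)` of depth `d` for a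
vector observable `X : Ω → ℝⁿ`, as a finite family of sets. -/
noncomputable def ordPartition {Ω : Type*} {n : ℕ} (X : Ω → Fin n → ℝ) (T : Ω → Ω)
    (d : ℕ) : Finset (Set Ω) :=
  letI := Classical.decEq (Set Ω)
  Finset.image
    (fun c : Fin n → Equiv.Perm (Fin (d + 1)) =>
      ⋂ i : Fin n, ordCell (fun ω => X ω i) T d (c i))
    Finset.univ

/-- A finite measurable partition of `Ω`. -/
def IsFinPart (P : Finset (Set Ω)) : Prop :=
  (∀ A ∈ P, MeasurableSet A) ∧ (P : Set (Set Ω)).PairwiseDisjoint id ∧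
    ⋃₀ (P : Set (Set Ω)) = Set.univ

/-- The join `P ∨ Q` of two partitions. -/
noncomputable def partJoin (P Q : Finset (Set Ω)) : Finset (Set Ω) :=
  letI := Classical.decEq (Set Ω)
  (P ×ˢ Q).image fun p => p.1 ∩ p.2

/-- `ajoin T P k = P ∨ T⁻¹P ∨ … ∨ T^{-(k-1)}P` (with `ajoin T P 0 = {univ}`). -/
noncomputable def ajoin (T : Ω → Ω) (P : Finset (Set Ω)) : ℕ → Finset (Set Ω)
  | 0 => {Set.univ}
  | k + 1 =>
    letI := Classical.decEq (Set Ω)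
    partJoin (ajoin T P k) (P.image fun A => T^[k] ⁻¹' A)

/-- The entropy `H_μ(P) = -∑_{A ∈ P} μ(A) log μ(A)`. -/
noncomputable def entH (μ : Measure Ω) (P : Finset (Set Ω)) : ℝ :=
  ∑ A ∈ P, Real.negMulLog (μ A).toReal

/-- The Kolmogorov–Sinai entropy of `T`: the supremum over all finite measurable
partitions `P` of the entropy rate `lim_k H_μ(P^{(k)})/k` (the limit exists and
is written here as a `liminf`). -/
noncomputable def ksEntropy (μ : Measure Ω) (T : Ω → Ω) : ENNReal :=
  ⨆ P : {P : Finset (Set Ω) // IsFinPart P},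
    ENNReal.ofReal (Filter.atTop.liminf fun k : ℕ => entH μ (ajoin T P.1 k) / k)

open scoped Topology

/-- Entropy does not decrease under refinement of a sum of nonnegative weights. -/
lemma negMulLog_sum_le {ι : Type*} (s : Finset ι) (p : ι → ℝ) (hp : ∀ i ∈ s, 0 ≤ p i) :
    Real.negMulLog (∑ i ∈ s, p i) ≤ ∑ i ∈ s, Real.negMulLog (p i) := by
  have h : Real.negMulLog (∑ i ∈ s, p i) = ∑ i ∈ s, -p i * Real.log (∑ j ∈ s, p j) := by
    rw [← Finset.sum_mul, Finset.sum_neg_distrib, Real.negMulLog]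
  rw [h]
  refine Finset.sum_le_sum fun i hi => ?_
  rcases (hp i hi).eq_or_lt with h0 | h0
  · simp [← h0]
  · have := Real.log_le_log h0 (Finset.single_le_sum hp hi)
    rw [Real.negMulLog]
    nlinarith

/-- The Gibbs inequality for a single weight. -/
lemma sub_le_mul_log_ratio {p r c s : ℝ} (hp : 0 ≤ p) (hr : p ≤ r) (hc : p ≤ c) (hs : r ≤ s) :
    p - r * c / s ≤ p * Real.log p + p * Real.log s - p * Real.log r - p * Real.log c := by
  rcases hp.eq_or_lt with h0 | h0
  · subst h0
    have : 0 ≤ r * c / s := div_nonneg (mul_nonneg hr hc) (hr.trans hs)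
    simpa using this
  · have hr0 : 0 < r := h0.trans_le hr
    have hc0 : 0 < c := h0.trans_le hc
    have hs0 : 0 < s := hr0.trans_le hs
    have h1 := Real.log_le_sub_one_of_pos (x := r * c / (s * p)) (by positivity)
    rw [Real.log_div (by positivity) (by positivity), Real.log_mul hr0.ne' hc0.ne',
      Real.log_mul hs0.ne' h0.ne'] at h1
    have h2 := mul_le_mul_of_nonneg_left h1 hp
    have h3 : p * (r * c / (s * p) - 1) = r * c / s - p := by field_simp
    rw [h3] at h2
    linarith

/-- Subadditivity of the (unnormalised) entropy of a finite matrix of weights. -/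
lemma negMulLog_matrix_le {ι κ : Type*} (s : Finset ι) (t : Finset κ) (p : ι → κ → ℝ)
    (hp : ∀ i ∈ s, ∀ j ∈ t, 0 ≤ p i j) :
    (∑ i ∈ s, ∑ j ∈ t, Real.negMulLog (p i j)) + Real.negMulLog (∑ i ∈ s, ∑ j ∈ t, p i j) ≤
      (∑ i ∈ s, Real.negMulLog (∑ j ∈ t, p i j)) + ∑ j ∈ t, Real.negMulLog (∑ i ∈ s, p i j) := by
  set r : ι → ℝ := fun i => ∑ j ∈ t, p i j with hr
  set c : κ → ℝ := fun j => ∑ i ∈ s, p i j with hc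
  set S : ℝ := ∑ i ∈ s, r i with hS
  have hr0 : ∀ i ∈ s, 0 ≤ r i := fun i hi => Finset.sum_nonneg (hp i hi)
  have hcS : ∑ j ∈ t, c j = S := Finset.sum_comm
  have key : ∀ i ∈ s, ∀ j ∈ t, p i j - r i * c j / S ≤ p i j * Real.log (p i j) +
      p i j * Real.log S - p i j * Real.log (r i) - p i j * Real.log (c j) := fun i hi j hj =>
    sub_le_mul_log_ratio (hp i hi j hj)
      (Finset.single_le_sum (f := fun j => p i j) (hp i hi) hj)
      (Finset.single_le_sum (f := fun i => p i j) (fun i hi => hp i hi j hj) hi)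
      (Finset.single_le_sum hr0 hi)
  have hsum := Finset.sum_le_sum fun i hi => Finset.sum_le_sum (key i hi)
  have hL : ∑ i ∈ s, ∑ j ∈ t, (p i j - r i * c j / S) = 0 := by
    have : ∑ i ∈ s, ∑ j ∈ t, r i * c j / S = S := by
      simp_rw [mul_div_assoc, ← Finset.mul_sum, ← Finset.sum_mul, ← Finset.sum_div, hcS]
      rw [← hS, mul_div_assoc', mul_self_div_self]
    simp_rw [Finset.sum_sub_distrib]
    rw [this]
    simp [hS, hr]
  have hR1 : ∑ i ∈ s, ∑ j ∈ t, p i j * Real.log S = -Real.negMulLog S := by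
    simp_rw [← Finset.sum_mul]
    simp [Real.negMulLog, hS, hr]
  have hR2 : ∑ i ∈ s, ∑ j ∈ t, p i j * Real.log (r i) = -∑ i ∈ s, Real.negMulLog (r i) := by
    simp_rw [← Finset.sum_mul]
    simp [Real.negMulLog, hr]
  have hR3 : ∑ i ∈ s, ∑ j ∈ t, p i j * Real.log (c j) = -∑ j ∈ t, Real.negMulLog (c j) := by
    rw [Finset.sum_comm]
    simp_rw [← Finset.sum_mul]
    simp [Real.negMulLog, hc]
  have hR4 : ∑ i ∈ s, ∑ j ∈ t, p i j * Real.log (p i j) =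
      -∑ i ∈ s, ∑ j ∈ t, Real.negMulLog (p i j) := by
    simp [Real.negMulLog]
  rw [hL] at hsum
  simp_rw [Finset.sum_sub_distrib, Finset.sum_add_distrib] at hsum
  rw [hR1, hR2, hR3, hR4] at hsum
  linarith

section Partitions

variable {P Q R : Finset (Set Ω)} {μ : Measure Ω} [IsProbabilityMeasure μ]

lemma mem_partJoin {Ω : Type*} {P Q : Finset (Set Ω)} {A : Set Ω} :
    A ∈ partJoin P Q ↔ ∃ B ∈ P, ∃ C ∈ Q, B ∩ C = A := by
  classical
  simp only [partJoin, Finset.mem_image, Finset.mem_product, Prod.exists]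
  grind

lemma partJoin_comm {Ω : Type*} (P Q : Finset (Set Ω)) : partJoin P Q = partJoin Q P := by
  ext A
  simp only [mem_partJoin]
  constructor <;> rintro ⟨B, hB, C, hC, rfl⟩ <;> exact ⟨C, hC, B, hB, inter_comm _ _⟩

lemma partJoin_assoc {Ω : Type*} (P Q R : Finset (Set Ω)) :
    partJoin (partJoin P Q) R = partJoin P (partJoin Q R) := by
  ext A
  simp only [mem_partJoin]
  constructor
  · rintro ⟨_, ⟨B, hB, C, hC, rfl⟩, D, hD, rfl⟩
    exact ⟨B, hB, _, ⟨C, hC, D, hD, rfl⟩, (inter_assoc _ _ _).symm⟩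
  · rintro ⟨B, hB, _, ⟨C, hC, D, hD, rfl⟩, rfl⟩
    exact ⟨_, ⟨B, hB, C, hC, rfl⟩, D, hD, inter_assoc _ _ _⟩

lemma partJoin_univ {Ω : Type*} (P : Finset (Set Ω)) : partJoin P {univ} = P := by
  ext A
  simp [mem_partJoin]

lemma isFinPart_univ : IsFinPart ({univ} : Finset (Set Ω)) := by
  simp [IsFinPart]

namespace IsFinPart

lemma exists_mem (hP : IsFinPart P) (ω : Ω) : ∃ A ∈ P, ω ∈ A := by
  have : ω ∈ ⋃₀ (P : Set (Set Ω)) := hP.2.2 ▸ mem_univ ω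
  simpa using this

lemma partJoin (hP : IsFinPart P) (hQ : IsFinPart Q) : IsFinPart (partJoin P Q) := by
  refine ⟨?_, ?_, ?_⟩
  · intro A hA
    obtain ⟨B, hB, C, hC, rfl⟩ := mem_partJoin.1 hA
    exact (hP.1 B hB).inter (hQ.1 C hC)
  · intro A hA A' hA' hne
    obtain ⟨B, hB, C, hC, rfl⟩ := mem_partJoin.1 hA
    obtain ⟨B', hB', C', hC', rfl⟩ := mem_partJoin.1 hA'
    by_cases h : B = B'
    · have hCC : C ≠ C' := by rintro rfl; exact hne (by rw [h])
      exact (hQ.2.1 hC hC' hCC).mono inter_subset_right inter_subset_right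
    · exact (hP.2.1 hB hB' h).mono inter_subset_left inter_subset_left
  · refine eq_univ_of_forall fun ω => ?_
    obtain ⟨B, hB, hωB⟩ := hP.exists_mem ω
    obtain ⟨C, hC, hωC⟩ := hQ.exists_mem ω
    exact ⟨B ∩ C, mem_partJoin.2 ⟨B, hB, C, hC, rfl⟩, hωB, hωC⟩

lemma sum_measureReal_inter (hQ : IsFinPart Q) (A : Set Ω) (hA : MeasurableSet A) :
    ∑ B ∈ Q, μ.real (A ∩ B) = μ.real A := by
  rw [← measureReal_biUnion_finset]
  · congr 1
    ext ω
    obtain ⟨B, hB, hω⟩ := hQ.exists_mem ω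
    simp only [mem_iUnion, mem_inter_iff, exists_prop]
    exact ⟨fun ⟨_, _, h, _⟩ => h, fun h => ⟨B, hB, h, hω⟩⟩
  · exact fun B hB C hC hne => (hQ.2.1 hB hC hne).mono inter_subset_right inter_subset_right
  · exact fun B hB => hA.inter (hQ.1 B hB)

lemma sum_measureReal_inter' (hQ : IsFinPart Q) (A : Set Ω) (hA : MeasurableSet A) :
    ∑ B ∈ Q, μ.real (B ∩ A) = μ.real A := by
  simp_rw [inter_comm _ A]
  exact hQ.sum_measureReal_inter A hA

lemma sum_partJoin (hP : IsFinPart P) (hQ : IsFinPart Q) (g : Set Ω → ℝ) (hg : g ∅ = 0) :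
    ∑ A ∈ _root_.partJoin P Q, g A = ∑ A ∈ P, ∑ B ∈ Q, g (A ∩ B) := by
  rw [_root_.partJoin, Finset.sum_image_of_disjoint hg, Finset.sum_product]
  rintro ⟨B, C⟩ hBC ⟨B', C'⟩ hBC' hne
  simp only [Finset.coe_product, mem_prod, Finset.mem_coe] at hBC hBC'
  by_cases h : B = B'
  · have hCC : C ≠ C' := by rintro rfl; exact hne (by rw [h])
    exact (hQ.2.1 hBC.2 hBC'.2 hCC).mono inter_subset_right inter_subset_right
  · exact (hP.2.1 hBC.1 hBC'.1 h).mono inter_subset_left inter_subset_left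

end IsFinPart

end Partitions

section Entropy

variable {P Q R : Finset (Set Ω)} {μ : Measure Ω}

lemma entH_eq_sum : entH μ P = ∑ A ∈ P, Real.negMulLog (μ.real A) := rfl

lemma entH_partJoin (hP : IsFinPart P) (hQ : IsFinPart Q) :
    entH μ (partJoin P Q) = ∑ A ∈ P, ∑ B ∈ Q, Real.negMulLog (μ.real (A ∩ B)) := by
  rw [entH_eq_sum, hP.sum_partJoin hQ (fun A => Real.negMulLog (μ.real A)) (by simp)]

variable [IsProbabilityMeasure μ]

lemma entH_nonneg : 0 ≤ entH μ P :=
  Finset.sum_nonneg fun _ _ => Real.negMulLog_nonneg measureReal_nonneg measureReal_le_one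

lemma entH_univ : entH μ ({univ} : Finset (Set Ω)) = 0 := by
  simp [entH_eq_sum]

lemma entH_le_partJoin (hP : IsFinPart P) (hQ : IsFinPart Q) :
    entH μ P ≤ entH μ (partJoin P Q) := by
  rw [entH_partJoin hP hQ, entH_eq_sum]
  refine Finset.sum_le_sum fun A hA => ?_
  rw [← hQ.sum_measureReal_inter A (hP.1 A hA)]
  exact negMulLog_sum_le _ _ fun _ _ => measureReal_nonneg

/-- Strong subadditivity of entropy. -/
lemma entH_submodular (hP : IsFinPart P) (hQ : IsFinPart Q) (hR : IsFinPart R) :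
    entH μ (partJoin R (partJoin P Q)) + entH μ R ≤
      entH μ (partJoin R P) + entH μ (partJoin R Q) := by
  rw [entH_partJoin hR (hP.partJoin hQ), entH_partJoin hR hP, entH_partJoin hR hQ, entH_eq_sum,
    ← Finset.sum_add_distrib, ← Finset.sum_add_distrib]
  refine Finset.sum_le_sum fun C hC => ?_
  have hC' := hR.1 C hC
  rw [hP.sum_partJoin hQ (fun A => Real.negMulLog (μ.real (C ∩ A))) (by simp)]
  have h1 : ∀ A ∈ P, ∑ B ∈ Q, μ.real (C ∩ (A ∩ B)) = μ.real (C ∩ A) := fun A hA => by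
    simp_rw [← inter_assoc]
    exact hQ.sum_measureReal_inter _ (hC'.inter (hP.1 A hA))
  have h2 : ∀ B ∈ Q, ∑ A ∈ P, μ.real (C ∩ (A ∩ B)) = μ.real (C ∩ B) := fun B hB => by
    simp_rw [inter_left_comm C _ B]
    exact hP.sum_measureReal_inter' _ (hC'.inter (hQ.1 B hB))
  have h := negMulLog_matrix_le P Q (fun A B => μ.real (C ∩ (A ∩ B)))
    fun _ _ _ _ => measureReal_nonneg
  rw [Finset.sum_congr rfl fun A hA => h1 A hA, hP.sum_measureReal_inter _ hC',
    Finset.sum_congr rfl fun A hA => congrArg Real.negMulLog (h1 A hA),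
    Finset.sum_congr rfl fun B hB => congrArg Real.negMulLog (h2 B hB)] at h
  exact h

lemma entH_partJoin_le (hP : IsFinPart P) (hQ : IsFinPart Q) :
    entH μ (partJoin P Q) ≤ entH μ P + entH μ Q := by
  have h := entH_submodular (μ := μ) hP hQ isFinPart_univ
  have e : ∀ P : Finset (Set Ω), partJoin {univ} P = P := fun P => by
    rw [partJoin_comm, partJoin_univ]
  rwa [entH_univ, add_zero, e, e, e] at h

/-- Subadditivity of conditional entropy `H(A ∨ B | C ∨ D) ≤ H(A | C) + H(B | D)`. -/
lemma entH_cond_partJoin_le {A B C D : Finset (Set Ω)} (hA : IsFinPart A) (hB : IsFinPart B)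
    (hC : IsFinPart C) (hD : IsFinPart D) :
    entH μ (partJoin (partJoin A B) (partJoin C D)) - entH μ (partJoin C D) ≤
      (entH μ (partJoin A C) - entH μ C) + (entH μ (partJoin B D) - entH μ D) := by
  have h1 := entH_submodular (μ := μ) hA hB (hC.partJoin hD)
  have h2 := entH_submodular (μ := μ) hA hD hC
  have h3 := entH_submodular (μ := μ) hB hC hD
  rw [partJoin_comm (partJoin A B), partJoin_comm A C, partJoin_comm B D]
  rw [partJoin_comm A D, ← partJoin_assoc] at h2
  rw [partJoin_comm B C, ← partJoin_assoc, partJoin_comm D C] at h3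
  linarith

/-- If `A` is approximated by a union of cells of `P`, then `A` contributes little to the
entropy of a partition conditioned on `P`. -/
lemma sum_cond_le (hP : IsFinPart P) {A t : Set Ω} (hA : MeasurableSet A)
    (ht : ∀ B ∈ P, B ⊆ t ∨ Disjoint B t) {ε η : ℝ} (hε : μ.real (symmDiff A t) ≤ ε)
    (hη : ∀ m, 0 ≤ m → m ≤ ε → Real.negMulLog m ≤ η) :
    ∑ B ∈ P, (Real.negMulLog (μ.real (A ∩ B)) + μ.real (A ∩ B) * Real.log (μ.real B)) ≤
      ε + η := by
  classical
  rw [← Finset.sum_filter_add_sum_filter_not P (fun B => B ⊆ t)]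
  have hpq : ∀ B, μ.real (A ∩ B) ≤ μ.real B := fun B => measureReal_mono inter_subset_right
  have hdisj : ∀ s : Finset (Set Ω), s ⊆ P → ∀ D : Set Ω,
      (s : Set (Set Ω)).PairwiseDisjoint fun B => D ∩ B := fun s hs D B hB C hC hne =>
    (hP.2.1 (hs hB) (hs hC) hne).mono inter_subset_right inter_subset_right
  refine add_le_add ?_ ?_
  · refine le_trans ?_ hε
    have h1 : ∀ B ∈ P.filter (fun B => B ⊆ t),
        Real.negMulLog (μ.real (A ∩ B)) + μ.real (A ∩ B) * Real.log (μ.real B) ≤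
          μ.real (Aᶜ ∩ B) := fun B hB => by
      have h := sub_le_mul_log_ratio (measureReal_nonneg (μ := μ) (s := A ∩ B)) (hpq B)
        (measureReal_le_one (μ := μ)) (measureReal_le_one (μ := μ) (s := B))
      have h' := measureReal_inter_add_sdiff (μ := μ) (s := B) hA
      have h'' : B \ A = Aᶜ ∩ B := by rw [sdiff_eq, inter_comm]
      rw [h'', inter_comm] at h'
      simp only [Real.log_one, mul_zero, mul_one, div_one] at h
      rw [Real.negMulLog]
      linarith
    refine (Finset.sum_le_sum h1).trans ?_
    rw [← measureReal_biUnion_finset (hdisj _ (Finset.filter_subset _ _) _)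
      fun B hB => hA.compl.inter (hP.1 B (Finset.mem_filter.1 hB).1)]
    refine measureReal_mono (iUnion₂_subset fun B hB ω hω => ?_)
    exact Or.inr ⟨(Finset.mem_filter.1 hB).2 hω.2, hω.1⟩
  · set F := P.filter (fun B => ¬ B ⊆ t) with hF
    have hFP : F ⊆ P := Finset.filter_subset _ _
    set m := ∑ B ∈ F, μ.real (A ∩ B) with hm
    have hmε : m ≤ ε := by
      refine le_trans ?_ hε
      rw [hm, ← measureReal_biUnion_finset (hdisj _ hFP _)
        fun B hB => hA.inter (hP.1 B (hFP hB))]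
      refine measureReal_mono (iUnion₂_subset fun B hB ω hω => ?_)
      have hBt := (ht B (hFP hB)).resolve_left (Finset.mem_filter.1 hB).2
      exact Or.inl ⟨hω.1, disjoint_left.1 hBt hω.2⟩
    have hm0 : 0 ≤ m := Finset.sum_nonneg fun _ _ => measureReal_nonneg
    refine le_trans ?_ (hη m hm0 hmε)
    have h1 : ∀ B ∈ F, Real.negMulLog (μ.real (A ∩ B)) + μ.real (A ∩ B) * Real.log (μ.real B) ≤
        μ.real B * m - μ.real (A ∩ B) - μ.real (A ∩ B) * Real.log m := fun B hB => by
      have h := sub_le_mul_log_ratio (measureReal_nonneg (μ := μ) (s := A ∩ B)) (hpq B)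
        (Finset.single_le_sum (f := fun B => μ.real (A ∩ B)) (fun _ _ => measureReal_nonneg) hB)
        (measureReal_le_one (μ := μ) (s := B))
      simp only [Real.log_one, mul_zero, div_one] at h
      rw [Real.negMulLog]
      linarith
    refine (Finset.sum_le_sum h1).trans ?_
    rw [Finset.sum_sub_distrib, Finset.sum_sub_distrib, ← Finset.sum_mul, ← Finset.sum_mul,
      Real.negMulLog, ← hm]
    have hq : ∑ B ∈ F, μ.real B ≤ 1 := by
      calc ∑ B ∈ F, μ.real B ≤ ∑ B ∈ P, μ.real B :=
            Finset.sum_le_sum_of_subset_of_nonneg hFP fun _ _ _ => measureReal_nonneg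
        _ = 1 := by simpa using hP.sum_measureReal_inter (μ := μ) univ MeasurableSet.univ
    nlinarith

/-- The conditional entropy `H(Q | P)` is small if each cell of `Q` is approximated by a union
of cells of `P`. -/
lemma entH_cond_le (hP : IsFinPart P) (hQ : IsFinPart Q) {ε η : ℝ}
    (h : ∀ A ∈ Q, ∃ t, (∀ B ∈ P, B ⊆ t ∨ Disjoint B t) ∧ μ.real (symmDiff A t) ≤ ε)
    (hη : ∀ m, 0 ≤ m → m ≤ ε → Real.negMulLog m ≤ η) :
    entH μ (partJoin Q P) - entH μ P ≤ Q.card * (ε + η) := by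
  have h1 : entH μ P = -∑ A ∈ Q, ∑ B ∈ P, μ.real (A ∩ B) * Real.log (μ.real B) := by
    rw [Finset.sum_comm, ← Finset.sum_neg_distrib, entH_eq_sum]
    refine Finset.sum_congr rfl fun B hB => ?_
    rw [← Finset.sum_mul, hQ.sum_measureReal_inter' B (hP.1 B hB), Real.negMulLog, neg_mul]
  rw [entH_partJoin hQ hP, h1, sub_neg_eq_add, ← Finset.sum_add_distrib, ← nsmul_eq_mul]
  refine Finset.sum_le_card_nsmul _ _ _ fun A hA => ?_
  obtain ⟨t, ht, hε⟩ := h A hA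
  rw [← Finset.sum_add_distrib]
  exact sum_cond_le hP (hQ.1 A hA) ht hε hη

end Entropy

section Dynamics

/-- The preimage `S⁻¹P` of a partition. -/
noncomputable def pull {Ω : Type*} (S : Ω → Ω) (P : Finset (Set Ω)) : Finset (Set Ω) :=
  letI := Classical.decEq (Set Ω)
  P.image fun A => S ⁻¹' A

lemma mem_pull {Ω : Type*} {S : Ω → Ω} {P : Finset (Set Ω)} {A : Set Ω} :
    A ∈ pull S P ↔ ∃ B ∈ P, S ⁻¹' B = A := by
  simp [pull]

lemma ajoin_succ {Ω : Type*} (T : Ω → Ω) (P : Finset (Set Ω)) (k : ℕ) :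
    ajoin T P (k + 1) = partJoin (ajoin T P k) (pull T^[k] P) := rfl

lemma pull_univ {Ω : Type*} (S : Ω → Ω) : pull S {univ} = {univ} := by
  ext A
  simp [mem_pull, eq_comm]

lemma pull_partJoin {Ω : Type*} (S : Ω → Ω) (P Q : Finset (Set Ω)) :
    pull S (partJoin P Q) = partJoin (pull S P) (pull S Q) := by
  ext A
  simp only [mem_pull, mem_partJoin]
  constructor
  · rintro ⟨_, ⟨B, hB, C, hC, rfl⟩, rfl⟩
    exact ⟨_, ⟨B, hB, rfl⟩, _, ⟨C, hC, rfl⟩, rfl⟩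
  · rintro ⟨_, ⟨B, hB, rfl⟩, _, ⟨C, hC, rfl⟩, rfl⟩
    exact ⟨_, ⟨B, hB, C, hC, rfl⟩, rfl⟩

lemma pull_pull {Ω : Type*} (S S' : Ω → Ω) (P : Finset (Set Ω)) :
    pull S (pull S' P) = pull (S' ∘ S) P := by
  ext A
  simp [mem_pull, preimage_comp]

lemma ajoin_add {Ω : Type*} (T : Ω → Ω) (P : Finset (Set Ω)) (k l : ℕ) :
    ajoin T P (k + l) = partJoin (ajoin T P k) (pull T^[k] (ajoin T P l)) := by
  induction l with
  | zero => simp [ajoin, pull_univ, partJoin_univ]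
  | succ l ih =>
    rw [← add_assoc, ajoin_succ, ih, ajoin_succ, pull_partJoin, partJoin_assoc, pull_pull,
      ← Function.iterate_add, add_comm l k]

variable {P Q : Finset (Set Ω)} {μ : Measure Ω} {S T : Ω → Ω}

lemma IsFinPart.pull (hP : IsFinPart P) (hS : Measurable S) : IsFinPart (pull S P) := by
  refine ⟨?_, ?_, ?_⟩
  · intro A hA
    obtain ⟨B, hB, rfl⟩ := mem_pull.1 hA
    exact hS (hP.1 B hB)
  · intro A hA A' hA' hne
    obtain ⟨B, hB, rfl⟩ := mem_pull.1 hA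
    obtain ⟨B', hB', rfl⟩ := mem_pull.1 hA'
    exact (hP.2.1 hB hB' fun h => hne (by rw [h])).preimage S
  · refine eq_univ_of_forall fun ω => ?_
    obtain ⟨B, hB, hω⟩ := hP.exists_mem (S ω)
    exact ⟨_, mem_pull.2 ⟨B, hB, rfl⟩, hω⟩

lemma IsFinPart.ajoin (hP : IsFinPart P) (hT : Measurable T) (k : ℕ) :
    IsFinPart (ajoin T P k) := by
  induction k with
  | zero => exact isFinPart_univ
  | succ k ih => exact ih.partJoin (hP.pull (hT.iterate k))

lemma entH_pull (hP : IsFinPart P) (hS : MeasurePreserving S μ μ) :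
    entH μ (pull S P) = entH μ P := by
  rw [entH_eq_sum, pull, Finset.sum_image_of_disjoint (by simp)]
  · refine Finset.sum_congr rfl fun A hA => ?_
    exact congrArg Real.negMulLog (hS.measureReal_preimage (hP.1 A hA).nullMeasurableSet)
  · exact fun B hB B' hB' hne => (hP.2.1 hB hB' hne).preimage S

variable [IsProbabilityMeasure μ]

lemma subadditive_entH_ajoin (hP : IsFinPart P) (hT : MeasurePreserving T μ μ) :
    Subadditive fun k => entH μ (ajoin T P k) := fun k l => by
  have hl := hP.ajoin hT.measurable l
  have h := entH_partJoin_le (μ := μ) (hP.ajoin hT.measurable k)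
    (hl.pull (hT.iterate k).measurable)
  rwa [← ajoin_add, entH_pull hl (hT.iterate k)] at h

lemma tendsto_entH_ajoin_div (hP : IsFinPart P) (hT : MeasurePreserving T μ μ) :
    Tendsto (fun k : ℕ => entH μ (ajoin T P k) / k) atTop
      (𝓝 (subadditive_entH_ajoin hP hT).lim) :=
  (subadditive_entH_ajoin hP hT).tendsto_lim
    ⟨0, by rintro _ ⟨k, rfl⟩; exact div_nonneg entH_nonneg k.cast_nonneg⟩

lemma entH_ajoin_le (hP : IsFinPart P) (hQ : IsFinPart Q) (hT : MeasurePreserving T μ μ) (k : ℕ) :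
    entH μ (partJoin (ajoin T Q k) (ajoin T P k)) - entH μ (ajoin T P k) ≤
      k * (entH μ (partJoin Q P) - entH μ P) := by
  induction k with
  | zero => simp [ajoin, partJoin_univ]
  | succ k ih =>
    have hTk := hT.iterate k
    have h := entH_cond_partJoin_le (μ := μ) (hQ.ajoin hT.measurable k) (hQ.pull hTk.measurable)
      (hP.ajoin hT.measurable k) (hP.pull hTk.measurable)
    rw [← pull_partJoin, entH_pull (hQ.partJoin hP) hTk, entH_pull hP hTk, ← ajoin_succ,
      ← ajoin_succ] at h
    push_cast
    linarith

/-- `h(Q) ≤ h(P) + H(Q | P)`. -/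
lemma entropyRate_le (hP : IsFinPart P) (hQ : IsFinPart Q) (hT : MeasurePreserving T μ μ) :
    (subadditive_entH_ajoin hQ hT).lim ≤
      (subadditive_entH_ajoin hP hT).lim + (entH μ (partJoin Q P) - entH μ P) := by
  refine le_of_tendsto_of_tendsto (tendsto_entH_ajoin_div hQ hT)
    ((tendsto_entH_ajoin_div hP hT).add_const _) ?_
  filter_upwards [eventually_gt_atTop 0] with k hk
  have hk' : (0 : ℝ) < k := by exact_mod_cast hk
  have h1 := entH_ajoin_le hP hQ hT k
  have h2 := entH_le_partJoin (μ := μ) (hQ.ajoin hT.measurable k) (hP.ajoin hT.measurable k)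
  rw [div_le_iff₀ hk', add_mul, div_mul_cancel₀ _ hk'.ne']
  linarith

end Dynamics

section MeanErgodic

variable {μ : Measure Ω} [IsProbabilityMeasure μ] {T : Ω → Ω}

/-- The mean ergodic theorem for visit frequencies: they converge in measure. -/
lemma tendsto_measure_visit_frequency (hT : Ergodic T μ) {B : Set Ω} (hB : MeasurableSet B)
    {δ : ℝ} (hδ : 0 < δ) :
    Tendsto (fun N : ℕ => μ {ω | δ ≤ |(N : ℝ)⁻¹ * ∑ k ∈ Finset.range N,
      B.indicator (fun _ => (1 : ℝ)) (T^[k] ω) - μ.real B|}) atTop (𝓝 0) := by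
  have hTm := hT.toMeasurePreserving
  set U : Lp ℝ 2 μ →L[ℝ] Lp ℝ 2 μ :=
    (Lp.compMeasurePreservingₗᵢ ℝ T hTm).toContinuousLinearMap with hU
  have hUf : (U : Lp ℝ 2 μ → Lp ℝ 2 μ) = Lp.compMeasurePreserving T hTm := rfl
  set x : Lp ℝ 2 μ := indicatorConstLp 2 hB (measure_ne_top μ B) (1 : ℝ) with hx
  set u : Lp ℝ 2 μ := indicatorConstLp 2 MeasurableSet.univ (measure_ne_top μ univ) (1 : ℝ) with hu
  set K := U.eqLocus (1 : Lp ℝ 2 μ →L[ℝ] Lp ℝ 2 μ) with hK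
  set p := K.orthogonalProjectionOnto x with hp
  have hlim := tendstoInMeasure_of_tendsto_Lp
    (U.tendsto_birkhoffAverage_orthogonalProjection
      (LinearIsometry.norm_toContinuousLinearMap_le _) x)
  have huK : u ∈ K := by
    change Lp.compMeasurePreserving T hTm u = u
    rw [hu, Lp.indicatorConstLp_compMeasurePreserving]
    rfl
  obtain ⟨c, hc⟩ : ∃ c, ((p : Lp ℝ 2 μ) : Ω → ℝ) =ᵐ[μ] Function.const Ω c := by
    refine hT.ae_eq_const_of_ae_eq_comp_ae (Lp.aestronglyMeasurable _) ?_
    have hfix : Lp.compMeasurePreserving T hTm (p : Lp ℝ 2 μ) = p := p.2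
    exact (Lp.coeFn_compMeasurePreserving _ hTm).symm.trans (by rw [hfix])
  have hcB : c = μ.real B := by
    have h : inner ℝ u (p : Lp ℝ 2 μ) = inner ℝ u x :=
      Submodule.inner_orthogonalProjectionOnto_eq_of_mem_left (⟨u, huK⟩ : K) x
    rw [hu, L2.inner_indicatorConstLp_one,
      L2.inner_indicatorConstLp_one, setIntegral_univ, setIntegral_univ,
      integral_congr_ae hc, hx, integral_indicatorConstLp] at h
    simpa using h
  rw [tendstoInMeasure_iff_norm] at hlim
  refine (hlim δ hδ).congr fun N => measure_congr ?_
  have hsum : ((birkhoffAverage ℝ U id N x : Lp ℝ 2 μ) : Ω → ℝ) =ᵐ[μ] fun ω => (N : ℝ)⁻¹ *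
      ∑ k ∈ Finset.range N, B.indicator (fun _ => (1 : ℝ)) (T^[k] ω) := by
    have hk : ∀ k, (U^[k] x : Ω → ℝ) =ᵐ[μ]
        fun ω => B.indicator (fun _ => (1 : ℝ)) (T^[k] ω) := fun k => by
      rw [hUf, Lp.compMeasurePreserving_iterate, hx, Lp.indicatorConstLp_compMeasurePreserving]
      exact indicatorConstLp_coeFn
    have h1 : (birkhoffAverage ℝ U id N x : Lp ℝ 2 μ) =
        (N : ℝ)⁻¹ • ∑ k ∈ Finset.range N, U^[k] x := rfl
    rw [h1]
    filter_upwards [Lp.coeFn_smul (N : ℝ)⁻¹ (∑ k ∈ Finset.range N, U^[k] x),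
      Lp.coeFn_finsetSum (Finset.range N) (fun k => U^[k] x), ae_all_iff.2 hk] with ω h2 h3 h4
    rw [h2, Pi.smul_apply, h3, Finset.sum_apply, Finset.sum_congr rfl fun k _ => h4 k, smul_eq_mul]
  filter_upwards [hsum, hc] with ω h1 h2
  apply propext
  change δ ≤ ‖_ - _‖ ↔ δ ≤ |_|
  rw [h1, h2, hcB, Real.norm_eq_abs]
  rfl

end MeanErgodic

section Ordinal

variable {T : Ω → Ω}

/-- The key by which the ordinal pattern of `ω` sorts the indices `0, …, d`. -/
def ordKey {Ω : Type*} (X : Ω → ℝ) (T : Ω → Ω) (d : ℕ) (ω : Ω) (j : Fin (d + 1)) :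
    (Lex (ℝ × ℕ))ᵒᵈ :=
  OrderDual.toDual (toLex (X (T^[(j : ℕ)] ω), (j : ℕ)))

lemma ordKey_lt_iff {Ω : Type*} {X : Ω → ℝ} {T : Ω → Ω} {d : ℕ} {ω : Ω} {a b : Fin (d + 1)} :
    ordKey X T d ω a < ordKey X T d ω b ↔ X (T^[(a : ℕ)] ω) > X (T^[(b : ℕ)] ω) ∨
      (X (T^[(a : ℕ)] ω) = X (T^[(b : ℕ)] ω) ∧ (b : ℕ) < (a : ℕ)) := by
  rw [ordKey, ordKey, OrderDual.toDual_lt_toDual, Prod.Lex.toLex_lt_toLex, eq_comm]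

lemma ordKey_injective {Ω : Type*} (X : Ω → ℝ) (T : Ω → Ω) (d : ℕ) (ω : Ω) :
    Function.Injective (ordKey X T d ω) := fun a b h => by
  simp only [ordKey, OrderDual.toDual_inj, toLex_inj, Prod.mk.injEq] at h
  exact Fin.ext h.2

lemma mem_ordCell_iff {Ω : Type*} {X : Ω → ℝ} {T : Ω → Ω} {d : ℕ}
    {π : Equiv.Perm (Fin (d + 1))} {ω : Ω} :
    ω ∈ ordCell X T d π ↔ StrictMono (ordKey X T d ω ∘ π) := by
  rw [Fin.strictMono_iff_lt_succ]
  exact forall_congr' fun τ => ordKey_lt_iff.symm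

lemma exists_mem_ordCell {Ω : Type*} (X : Ω → ℝ) (T : Ω → Ω) (d : ℕ) (ω : Ω) :
    ∃ π, ω ∈ ordCell X T d π :=
  ⟨Tuple.sort (ordKey X T d ω), mem_ordCell_iff.2 <| (Tuple.monotone_sort _).strictMono_of_injective
    ((ordKey_injective X T d ω).comp (Equiv.injective _))⟩

lemma ordCell_unique {Ω : Type*} {X : Ω → ℝ} {T : Ω → Ω} {d : ℕ}
    {π σ : Equiv.Perm (Fin (d + 1))} {ω : Ω} (hπ : ω ∈ ordCell X T d π)
    (hσ : ω ∈ ordCell X T d σ) : π = σ := by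
  have h := Tuple.unique_monotone (mem_ordCell_iff.1 hπ).monotone (mem_ordCell_iff.1 hσ).monotone
  exact Equiv.ext fun j => ordKey_injective X T d ω (congrFun h j)

lemma lt_iff_of_mem_ordCell {Ω : Type*} {X : Ω → ℝ} {T : Ω → Ω} {d : ℕ}
    {π : Equiv.Perm (Fin (d + 1))} {ω : Ω} (hω : ω ∈ ordCell X T d π) {a b : Fin (d + 1)}
    (hab : a ≤ b) : X (T^[(b : ℕ)] ω) < X (T^[(a : ℕ)] ω) ↔ π.symm a < π.symm b := by
  rw [← (mem_ordCell_iff.1 hω).lt_iff_lt]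
  simp only [Function.comp_apply, Equiv.apply_symm_apply]
  rw [ordKey_lt_iff]
  have : ¬ (b : ℕ) < (a : ℕ) := not_lt.2 hab
  tauto

lemma measurableSet_ordCell {X : Ω → ℝ} (hX : Measurable X) (hT : Measurable T) (d : ℕ)
    (π : Equiv.Perm (Fin (d + 1))) : MeasurableSet (ordCell X T d π) := by
  have hXk : ∀ k, Measurable fun ω => X (T^[k] ω) := fun k => hX.comp (hT.iterate k)
  rw [ordCell, ofPred_forall]
  exact MeasurableSet.iInter fun τ => (measurableSet_lt (hXk _) (hXk _)).union
    ((measurableSet_eq_fun (hXk _) (hXk _)).inter (MeasurableSet.const _))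

variable {n : ℕ} {X : Ω → Fin n → ℝ}

lemma mem_ordPartition {Ω : Type*} {n : ℕ} {X : Ω → Fin n → ℝ} {T : Ω → Ω} {d : ℕ} {A : Set Ω} :
    A ∈ ordPartition X T d ↔ ∃ c : Fin n → Equiv.Perm (Fin (d + 1)),
      ⋂ i : Fin n, ordCell (fun ω => X ω i) T d (c i) = A := by
  simp [ordPartition]

lemma isFinPart_ordPartition (hX : Measurable X) (hT : Measurable T) (d : ℕ) :
    IsFinPart (ordPartition X T d) := by
  refine ⟨?_, ?_, ?_⟩
  · intro A hA
    obtain ⟨c, rfl⟩ := mem_ordPartition.1 hA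
    exact MeasurableSet.iInter fun i => measurableSet_ordCell (measurable_pi_iff.1 hX i) hT d _
  · intro A hA A' hA' hne
    obtain ⟨c, rfl⟩ := mem_ordPartition.1 hA
    obtain ⟨c', rfl⟩ := mem_ordPartition.1 hA'
    refine disjoint_left.2 fun ω hω hω' => hne ?_
    have : c = c' := funext fun i => ordCell_unique (mem_iInter.1 hω i) (mem_iInter.1 hω' i)
    rw [this]
  · refine eq_univ_of_forall fun ω => ?_
    choose c hc using fun i => exists_mem_ordCell (fun ω => X ω i) T d ω
    exact ⟨_, mem_ordPartition.2 ⟨c, rfl⟩, mem_iInter.2 hc⟩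

/-- The proportion of times `j < N` at which the orbit of `ω` is strictly below its start. -/
noncomputable def belowFrequency {Ω : Type*} (Y : Ω → ℝ) (T : Ω → Ω) (N : ℕ) (ω : Ω) : ℝ :=
  (N : ℝ)⁻¹ * ∑ j ∈ Finset.range N, (Iio (Y ω)).indicator (fun _ => (1 : ℝ)) (Y (T^[j] ω))

/-- Ordinal partitions of sufficient depth determine `belowFrequency` along the orbit. -/
lemma ordPartition_saturated {Ω : Type*} {n : ℕ} (X : Ω → Fin n → ℝ) (T : Ω → Ω) (i : Fin n)
    (k N : ℕ) (q : ℝ) {D : ℕ} (hD : k + N ≤ D) {B : Set Ω} (hB : B ∈ ordPartition X T D) :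
    B ⊆ T^[k] ⁻¹' {ω | belowFrequency (fun ω => X ω i) T N ω < q} ∨
      Disjoint B (T^[k] ⁻¹' {ω | belowFrequency (fun ω => X ω i) T N ω < q}) := by
  obtain ⟨c, rfl⟩ := mem_ordPartition.1 hB
  set B := ⋂ i : Fin n, ordCell (fun ω => X ω i) T D (c i) with hBdef
  have key : ∀ ω ∈ B, ∀ ω' ∈ B, belowFrequency (fun ω => X ω i) T N (T^[k] ω) =
      belowFrequency (fun ω => X ω i) T N (T^[k] ω') := fun ω hω ω' hω' => by
    rw [belowFrequency, belowFrequency]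
    congr 1
    refine Finset.sum_congr rfl fun j hj => ?_
    have hj' := Finset.mem_range.1 hj
    have hab : (⟨k, by omega⟩ : Fin (D + 1)) ≤ ⟨j + k, by omega⟩ := by
      simp
    have h := (lt_iff_of_mem_ordCell (mem_iInter.1 hω i) hab).trans
      (lt_iff_of_mem_ordCell (mem_iInter.1 hω' i) hab).symm
    simp only [Function.iterate_add_apply] at h
    simp only [indicator_apply, mem_Iio, h]
  by_cases h : ∃ ω ∈ B, belowFrequency (fun ω => X ω i) T N (T^[k] ω) < q
  · obtain ⟨ω, hω, hq⟩ := h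
    left
    intro ω' hω'
    rw [mem_preimage, mem_ofPred_eq, key ω' hω' ω hω]
    exact hq
  · push Not at h
    exact Or.inr (disjoint_left.2 fun ω hω => not_lt.2 (h ω hω))

end Ordinal

section Quantile

variable {μ : Measure Ω} [IsProbabilityMeasure μ] {T : Ω → Ω}

lemma measureReal_iUnion_le {f : ℕ → Set Ω} (hf : Monotone f) {c : ℝ}
    (hc : ∀ k, μ.real (f k) ≤ c) : μ.real (⋃ k, f k) ≤ c := by
  have h := (ENNReal.tendsto_toReal (measure_ne_top μ (⋃ k, f k))).comp
    (tendsto_measure_iUnion_atTop (μ := μ) hf)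
  exact le_of_tendsto' h hc

lemma exists_quantile_gap (Y : Ω → ℝ) {a ε : ℝ}
    (ha : 0 < μ.real {ω | Y ω < a}) (hε : 0 < ε) (hY : Measurable Y) :
    ∃ b, μ.real {ω | Y ω < b} < μ.real {ω | Y ω < a} ∧ μ.real {ω | b < Y ω ∧ Y ω < a} ≤ ε := by
  set L : ℝ → ℝ := fun b => μ.real {ω | Y ω < b} with hL
  have hmono : Monotone L := fun b c hbc => measureReal_mono fun ω hω => lt_of_lt_of_le hω hbc
  have hanti : Antitone fun k : ℕ => (1 : ℝ) / (k + 1) := fun k l hkl =>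
    one_div_le_one_div_of_le (by positivity) (by exact_mod_cast Nat.succ_le_succ hkl)
  have hpos : ∀ k : ℕ, (0 : ℝ) < 1 / (k + 1) := fun k => by positivity
  obtain ⟨η, hη0, hηε, hηa⟩ : ∃ η, 0 < η ∧ η ≤ ε ∧ η < L a :=
    ⟨min ε (L a / 2), lt_min hε (half_pos ha), min_le_left _ _,
      (min_le_right _ _).trans_lt (half_lt_self ha)⟩
  set S : Set ℝ := {b | L b ≤ L a - η} with hS
  have hSne : S.Nonempty := by
    by_contra h
    rw [not_nonempty_iff_eq_empty] at h
    have h1 : ∀ k : ℕ, μ.real {ω | -(k : ℝ) ≤ Y ω} ≤ 1 - (L a - η) := fun k => by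
      have h2 : -(k : ℝ) ∉ S := h ▸ notMem_empty _
      have h3 : L (-(k : ℝ)) + μ.real {ω | Y ω < -(k : ℝ)}ᶜ = μ.real univ :=
        measureReal_add_measureReal_compl (measurableSet_lt hY measurable_const)
      have h4 : {ω | Y ω < -(k : ℝ)}ᶜ = {ω | -(k : ℝ) ≤ Y ω} := by ext; simp
      rw [h4, probReal_univ] at h3
      rw [hS, mem_ofPred_eq, not_le] at h2
      linarith
    have h5 := measureReal_iUnion_le (μ := μ) (f := fun k : ℕ => {ω | -(k : ℝ) ≤ Y ω})
      (fun k l hkl ω hω => by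
        have : (k : ℝ) ≤ l := by exact_mod_cast hkl
        simp only [mem_ofPred_eq] at hω ⊢
        linarith) h1
    have h6 : ⋃ k : ℕ, {ω | -(k : ℝ) ≤ Y ω} = univ := eq_univ_of_forall fun ω => by
      obtain ⟨k, hk⟩ := exists_nat_ge (-Y ω)
      exact mem_iUnion.2 ⟨k, by rw [mem_ofPred_eq]; linarith⟩
    rw [h6, probReal_univ] at h5
    linarith
  have hSb : BddAbove S := ⟨a, fun b hb => by
    by_contra h
    have h1 : L a ≤ L b := hmono (not_le.1 h).le
    have h2 : L b ≤ L a - η := hb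
    linarith⟩
  refine ⟨sSup S, ?_, ?_⟩
  · have h1 : {ω | Y ω < sSup S} = ⋃ k : ℕ, {ω | Y ω < sSup S - 1 / (k + 1)} := by
      ext ω
      simp only [mem_ofPred_eq, mem_iUnion]
      constructor
      · intro h
        obtain ⟨k, hk⟩ := exists_nat_one_div_lt (sub_pos.2 h)
        exact ⟨k, by linarith⟩
      · rintro ⟨k, hk⟩
        linarith [hpos k]
    have h2 : L (sSup S) ≤ L a - η := by
      rw [hL]
      simp only
      rw [h1]
      refine measureReal_iUnion_le (fun k l hkl ω hω => ?_) fun k => ?_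
      · have := hanti hkl
        simp only [mem_ofPred_eq] at hω this ⊢
        linarith
      · obtain ⟨s, hs, hlt⟩ := exists_lt_of_lt_csSup hSne (sub_lt_self (sSup S) (hpos k))
        exact (hmono hlt.le).trans hs
    linarith
  · have h1 : {ω | sSup S < Y ω ∧ Y ω < a} =
        ⋃ k : ℕ, {ω | sSup S + 1 / (k + 1) ≤ Y ω ∧ Y ω < a} := by
      ext ω
      simp only [mem_ofPred_eq, mem_iUnion]
      constructor
      · rintro ⟨h, h'⟩
        obtain ⟨k, hk⟩ := exists_nat_one_div_lt (sub_pos.2 h)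
        exact ⟨k, by linarith, h'⟩
      · rintro ⟨k, hk, h'⟩
        exact ⟨by linarith [hpos k], h'⟩
    rw [h1]
    refine measureReal_iUnion_le (fun k l hkl ω hω => ?_) fun k => ?_
    · have := hanti hkl
      simp only [mem_ofPred_eq] at hω this ⊢
      exact ⟨by linarith, hω.2⟩
    · refine le_trans ?_ hηε
      set c := sSup S + 1 / ((k : ℝ) + 1) with hc
      have hcS : c ∉ S := fun h => by linarith [le_csSup hSb h, hpos k]
      rw [hS, mem_ofPred_eq, not_le] at hcS
      by_cases hca : c ≤ a
      · have h2 : {ω | Y ω < a} \ {ω | Y ω < c} = {ω | c ≤ Y ω ∧ Y ω < a} := by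
          ext ω
          simp [and_comm]
        have h3 := measureReal_sdiff_add_inter (μ := μ) (s := {ω | Y ω < a})
          (measurableSet_lt hY (measurable_const (a := c)))
        have h4 : {ω | Y ω < a} ∩ {ω | Y ω < c} = {ω | Y ω < c} := by
          ext ω
          exact ⟨And.right, fun h => ⟨lt_of_lt_of_le h hca, h⟩⟩
        rw [h2, h4] at h3
        change L a - η < μ.real {ω | Y ω < c} at hcS
        change _ = L a at h3
        linarith
      · have h2 : {ω | c ≤ Y ω ∧ Y ω < a} = ∅ := by
          ext ω
          simp only [mem_ofPred_eq, mem_empty_iff_false, iff_false]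
          rintro ⟨h, h'⟩
          linarith
        rw [h2]
        simpa using hη0.le

/-- Sublevel sets of an observable are approximated by level sets of `belowFrequency`. -/
lemma exists_belowFrequency_approx (hT : Ergodic T μ) {Y : Ω → ℝ} (hY : Measurable Y) (a : ℝ)
    {ε : ℝ} (hε : 0 < ε) :
    ∃ (N : ℕ) (q : ℝ), μ.real (symmDiff {ω | Y ω < a} {ω | belowFrequency Y T N ω < q}) ≤ ε := by
  rcases (measureReal_nonneg (μ := μ) (s := {ω | Y ω < a})).eq_or_lt with h0 | h0
  · refine ⟨0, 0, ?_⟩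
    have : {ω | belowFrequency Y T 0 ω < 0} = ∅ := by ext; simp [belowFrequency]
    rw [this, ← bot_eq_empty, symmDiff_bot, ← h0]
    exact hε.le
  obtain ⟨b, hb, hgap⟩ := exists_quantile_gap Y h0 (div_pos hε three_pos) hY
  set La := μ.real {ω | Y ω < a}
  set Lb := μ.real {ω | Y ω < b}
  set δ := (La - Lb) / 2 with hδ
  have hδ0 : 0 < δ := half_pos (sub_pos.2 hb)
  have hev : ∀ c, ∀ᶠ N : ℕ in atTop, μ.real {ω | δ ≤ |(N : ℝ)⁻¹ * ∑ k ∈ Finset.range N,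
      {ω | Y ω < c}.indicator (fun _ => (1 : ℝ)) (T^[k] ω) - μ.real {ω | Y ω < c}|} ≤ ε / 3 :=
    fun c => by
      have h := (ENNReal.tendsto_toReal ENNReal.zero_ne_top).comp
        (tendsto_measure_visit_frequency hT (measurableSet_lt hY (measurable_const (a := c))) hδ0)
      exact h.eventually_le_const (by simpa using hε)
  obtain ⟨N, hNa, hNb⟩ := ((hev a).and (hev b)).exists
  refine ⟨N, (La + Lb) / 2, ?_⟩
  have hcmp : ∀ c c' ω, c ≤ c' → (N : ℝ)⁻¹ * ∑ j ∈ Finset.range N,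
      (Iio c).indicator (fun _ => (1 : ℝ)) (Y (T^[j] ω)) ≤ (N : ℝ)⁻¹ * ∑ j ∈ Finset.range N,
      (Iio c').indicator (fun _ => (1 : ℝ)) (Y (T^[j] ω)) := fun c c' ω hcc =>
    mul_le_mul_of_nonneg_left (Finset.sum_le_sum fun j _ =>
      indicator_le_indicator_of_subset (Iio_subset_Iio hcc) (fun _ => zero_le_one) _)
      (by positivity)
  have hsub : symmDiff {ω | Y ω < a} {ω | belowFrequency Y T N ω < (La + Lb) / 2} ⊆
      ({ω | b < Y ω ∧ Y ω < a} ∪ {ω | δ ≤ |(N : ℝ)⁻¹ * ∑ k ∈ Finset.range N,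
        {ω | Y ω < a}.indicator (fun _ => (1 : ℝ)) (T^[k] ω) - La|}) ∪
        {ω | δ ≤ |(N : ℝ)⁻¹ * ∑ k ∈ Finset.range N,
        {ω | Y ω < b}.indicator (fun _ => (1 : ℝ)) (T^[k] ω) - Lb|} := by
    intro ω hω
    by_contra hcon
    simp only [mem_union, mem_ofPred_eq, not_or, not_and, not_lt, not_le] at hcon
    obtain ⟨⟨h1, h2⟩, h3⟩ := hcon
    have h2' := (abs_lt.1 h2).1
    have h3' := (abs_lt.1 h3).2
    rcases hω with ⟨hYa, hf⟩ | ⟨hf, hYa⟩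
    · have hYb : Y ω ≤ b := by
        by_contra h
        exact absurd (h1 (not_le.1 h)) (not_le.2 hYa)
      refine hf (lt_of_le_of_lt (hcmp _ _ ω hYb) ?_)
      change _ - Lb < δ at h3'
      change (N : ℝ)⁻¹ * ∑ k ∈ Finset.range N,
        {ω | Y ω < b}.indicator (fun _ => (1 : ℝ)) (T^[k] ω) < _
      linarith
    · have h4 := (hcmp _ _ ω (not_lt.1 hYa)).trans_lt hf
      change (N : ℝ)⁻¹ * ∑ k ∈ Finset.range N,
        {ω | Y ω < a}.indicator (fun _ => (1 : ℝ)) (T^[k] ω) < _ at h4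
      linarith
  calc _ ≤ _ := measureReal_mono hsub
    _ ≤ _ := (measureReal_union_le _ _).trans (add_le_add_left (measureReal_union_le _ _) _)
    _ ≤ ε / 3 + ε / 3 + ε / 3 := add_le_add (add_le_add hgap hNa) hNb
    _ = ε := by ring

end Quantile

section Approximation

/-- A set is approximable by a sequence of partitions if, up to arbitrarily small error, it is
a union of cells of all sufficiently late partitions. -/
def Approximable (μ : Measure Ω) (P : ℕ → Finset (Set Ω)) (s : Set Ω) : Prop :=
  ∀ ε : ℝ, 0 < ε → ∀ᶠ d in atTop, ∃ t, (∀ B ∈ P d, B ⊆ t ∨ Disjoint B t) ∧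
    μ.real (symmDiff s t) ≤ ε

variable {μ : Measure Ω}

lemma Approximable.compl {P : ℕ → Finset (Set Ω)} {s : Set Ω} (hs : Approximable μ P s) :
    Approximable μ P sᶜ := fun ε hε => by
  filter_upwards [hs ε hε] with d ⟨t, ht, hst⟩
  refine ⟨tᶜ, fun B hB => ?_, ?_⟩
  · rw [subset_compl_iff_disjoint_right, disjoint_compl_right_iff_subset]
    exact (ht B hB).symm
  · rwa [compl_symmDiff_compl]

lemma approximable_empty (P : ℕ → Finset (Set Ω)) : Approximable μ P ∅ := fun ε hε =>
  Eventually.of_forall fun d => ⟨∅, fun B _ => Or.inr (disjoint_empty B), by simpa using hε.le⟩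

variable [IsProbabilityMeasure μ] {T : Ω → Ω}

lemma Approximable.union {P : ℕ → Finset (Set Ω)} {s s' : Set Ω} (hs : Approximable μ P s)
    (hs' : Approximable μ P s') : Approximable μ P (s ∪ s') := fun ε hε => by
  filter_upwards [hs _ (half_pos hε), hs' _ (half_pos hε)] with d ⟨t, ht, hst⟩ ⟨t', ht', hst'⟩
  refine ⟨t ∪ t', fun B hB => ?_, ?_⟩
  · rcases ht B hB with h | h
    · exact Or.inl (h.trans subset_union_left)
    · rcases ht' B hB with h' | h'
      · exact Or.inl (h'.trans subset_union_right)
      · exact Or.inr (disjoint_union_right.2 ⟨h, h'⟩)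
  · have hsub : symmDiff (s ∪ s') (t ∪ t') ⊆ symmDiff s t ∪ symmDiff s' t' := by
      intro ω
      simp only [mem_symmDiff, mem_union]
      tauto
    calc _ ≤ _ := measureReal_mono hsub
      _ ≤ _ := measureReal_union_le _ _
      _ ≤ ε / 2 + ε / 2 := add_le_add hst hst'
      _ = ε := add_halves ε

/-- Being approximable is stable under limits in measure. -/
lemma approximable_of_forall {P : ℕ → Finset (Set Ω)} {s : Set Ω}
    (h : ∀ ε : ℝ, 0 < ε → ∃ s', Approximable μ P s' ∧ μ.real (symmDiff s s') ≤ ε) :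
    Approximable μ P s := fun ε hε => by
  obtain ⟨s', hs', hss'⟩ := h _ (half_pos hε)
  filter_upwards [hs' _ (half_pos hε)] with d ⟨t, ht, hst⟩
  refine ⟨t, ht, ?_⟩
  calc _ ≤ _ := measureReal_mono (symmDiff_triangle s s' t)
    _ ≤ _ := measureReal_union_le _ _
    _ ≤ ε / 2 + ε / 2 := add_le_add hss' hst
    _ = ε := add_halves ε

lemma approximable_iUnion {P : ℕ → Finset (Set Ω)} {f : ℕ → Set Ω}
    (hm : ∀ k, MeasurableSet (f k)) (hf : ∀ k, Approximable μ P (f k)) :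
    Approximable μ P (⋃ k, f k) := by
  have hacc : ∀ k, Approximable μ P (accumulate f k) := fun k => by
    induction k with
    | zero => simpa [accumulate] using hf 0
    | succ k ih => rw [accumulate_succ]; exact ih.union (hf _)
  have hlim : Tendsto (fun k => μ.real (accumulate f k)) atTop (𝓝 (μ.real (⋃ k, f k))) :=
    (ENNReal.tendsto_toReal (measure_ne_top μ _)).comp tendsto_measure_iUnion_accumulate
  refine approximable_of_forall fun ε hε => ?_
  obtain ⟨k, hk⟩ := (hlim.eventually_const_le (sub_lt_self _ hε)).exists
  refine ⟨accumulate f k, hacc k, ?_⟩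
  have hsub : accumulate f k ⊆ ⋃ k, f k := accumulate_subset_iUnion k
  have hmk : MeasurableSet (accumulate f k) :=
    MeasurableSet.biUnion (to_countable _) fun j _ => hm j
  rw [symmDiff_of_ge hsub, measureReal_sdiff hsub hmk]
  linarith

/-- The measurable sets approximable by a sequence of partitions form a σ-algebra. -/
abbrev approxSpace (μ : Measure Ω) [IsProbabilityMeasure μ] (P : ℕ → Finset (Set Ω)) :
    MeasurableSpace Ω where
  MeasurableSet' s := MeasurableSet s ∧ Approximable μ P s
  measurableSet_empty := ⟨MeasurableSet.empty, approximable_empty P⟩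
  measurableSet_compl _ hs := ⟨hs.1.compl, hs.2.compl⟩
  measurableSet_iUnion _ hf := ⟨MeasurableSet.iUnion fun k => (hf k).1,
    approximable_iUnion (fun k => (hf k).1) fun k => (hf k).2⟩

lemma measurable_belowFrequency {Y : Ω → ℝ} (hY : Measurable Y) (hT : Measurable T) (N : ℕ) :
    Measurable (belowFrequency Y T N) := by
  refine measurable_const.mul (Finset.measurable_sum _ fun j _ => ?_)
  exact Measurable.ite (measurableSet_lt (hY.comp (hT.iterate j)) hY) measurable_const
    measurable_const

lemma approximable_preimage_lt (hT : Ergodic T μ) {n : ℕ} {X : Ω → Fin n → ℝ}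
    (hX : Measurable X) (i : Fin n) (k : ℕ) (a : ℝ) :
    Approximable μ (ordPartition X T) {ω | X (T^[k] ω) i < a} := fun ε hε => by
  have hY : Measurable fun ω => X ω i := measurable_pi_iff.1 hX i
  obtain ⟨N, q, h⟩ := exists_belowFrequency_approx hT hY a hε
  filter_upwards [eventually_ge_atTop (k + N)] with d hd
  refine ⟨_, fun B hB => ordPartition_saturated X T i k N q hd hB, ?_⟩
  refine le_of_eq_of_le ?_ h
  exact (hT.toMeasurePreserving.iterate k).measureReal_preimage
    ((measurableSet_lt hY measurable_const).symmDiff (measurableSet_lt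
      (measurable_belowFrequency hY hT.measurable N) measurable_const)).nullMeasurableSet

lemma approximable_of_generating (hT : Ergodic T μ) {n : ℕ} {X : Ω → Fin n → ℝ}
    (hX : Measurable X)
    (hgen : ∀ s : Set Ω, MeasurableSet s → ∃ t : Set Ω,
      MeasurableSet[⨆ k : ℕ, MeasurableSpace.comap (fun ω => X (T^[k] ω))
        (borel (Fin n → ℝ))] t ∧ μ (symmDiff s t) = 0)
    {s : Set Ω} (hs : MeasurableSet s) : Approximable μ (ordPartition X T) s := by
  have hle : ⨆ k : ℕ, MeasurableSpace.comap (fun ω => X (T^[k] ω)) (borel (Fin n → ℝ)) ≤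
      approxSpace μ (ordPartition X T) := iSup_le fun k => by
    rw [← BorelSpace.measurable_eq (α := Fin n → ℝ), ← measurable_iff_comap_le]
    refine (@measurable_pi_iff _ _ _ (approxSpace μ (ordPartition X T)) _ _).2 fun i =>
      @measurable_of_Iio _ _ _ _ _ (approxSpace μ (ordPartition X T)) _ _ _ _ fun a => ?_
    exact ⟨measurableSet_lt (measurable_pi_iff.1 (hX.comp (hT.measurable.iterate k)) i)
      measurable_const, approximable_preimage_lt hT hX i k a⟩
  obtain ⟨t, ht, hst⟩ := hgen s hs
  exact approximable_of_forall fun ε hε =>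
    ⟨t, (hle t ht).2, by rw [measureReal_def, hst]; exact hε.le⟩

/-- If a finite partition `Q` is approximable by the partitions `P d`, then its entropy rate
is at most that of `P d` for large `d`, up to an arbitrarily small error. -/
lemma eventually_entropyRate_le {P : ℕ → Finset (Set Ω)} (hP : ∀ d, IsFinPart (P d))
    {Q : Finset (Set Ω)} (hQ : IsFinPart Q) (hT : MeasurePreserving T μ μ)
    (hPQ : ∀ A ∈ Q, Approximable μ P A) {ε : ℝ} (hε : 0 < ε) :
    ∀ᶠ d in atTop, (subadditive_entH_ajoin hQ hT).lim ≤
      (subadditive_entH_ajoin (hP d) hT).lim + ε := by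
  set η := ε / (2 * (Q.card + 1)) with hη
  have hη0 : 0 < η := by positivity
  have hcont : ∀ᶠ x in 𝓝 (0 : ℝ), Real.negMulLog x < η :=
    Real.continuous_negMulLog.continuousAt.eventually_lt_const (by simpa using hη0)
  obtain ⟨r, hr, hball⟩ := Metric.eventually_nhds_iff.1 hcont
  have hevent : ∀ᶠ d in atTop, ∀ A ∈ Q, ∃ t, (∀ B ∈ P d, B ⊆ t ∨ Disjoint B t) ∧
      μ.real (symmDiff A t) ≤ min η (r / 2) :=
    (Finset.eventually_all Q).2 fun A hA => hPQ A hA _ (lt_min hη0 (half_pos hr))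
  filter_upwards [hevent] with d hd
  have h1 := entH_cond_le (hP d) hQ hd (η := η) fun m hm0 hm => (hball (by
    rw [Real.dist_0_eq_abs, abs_of_nonneg hm0]
    exact (hm.trans (min_le_right _ _)).trans_lt (half_lt_self hr))).le
  have h2 : (Q.card : ℝ) * (min η (r / 2) + η) ≤ ε :=
    calc (Q.card : ℝ) * (min η (r / 2) + η) ≤ (Q.card + 1) * (η + η) := by
          gcongr
          · linarith
          · exact min_le_left _ _
      _ = ε := by rw [hη]; field_simp; norm_num
  linarith [entropyRate_le (hP d) hQ hT]

end Approximation

/-- For an ergodic `μ`-preserving `T` on a probability space and a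
measurable `X : Ω → ℝⁿ` with `σ({X∘T^k}_{k≥0})` equivalent to `𝔉` modulo
`μ`-null sets, the Kolmogorov–Sinai entropy of `T` equals
`lim_{d→∞} lim_{k→∞} (1/k) H_μ((𝒫_d(X,T))^{(k)})`. -/
theorem stmt19 (μ : Measure Ω) [IsProbabilityMeasure μ]
    (T : Ω → Ω) (hT : Ergodic T μ)
    {n : ℕ} (X : Ω → Fin n → ℝ) (hX : Measurable X)
    (hgen₁ : ∀ s : Set Ω, MeasurableSet s →
      ∃ t : Set Ω,
        MeasurableSet[⨆ k : ℕ, MeasurableSpace.comap (fun ω => X (T^[k] ω)) (borel (Fin n → ℝ))] t ∧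
        μ (symmDiff s t) = 0)
    (hgen₂ : ∀ s : Set Ω,
      MeasurableSet[⨆ k : ℕ, MeasurableSpace.comap (fun ω => X (T^[k] ω)) (borel (Fin n → ℝ))] s →
      ∃ t : Set Ω, MeasurableSet t ∧ μ (symmDiff s t) = 0) :
    ∃ h : ℕ → ℝ,
      (∀ d, Tendsto (fun k : ℕ => entH μ (ajoin T (ordPartition X T d) k) / k) atTop
        (nhds (h d))) ∧
      Tendsto (fun d => ENNReal.ofReal (h d)) atTop (nhds (ksEntropy μ T)) := by
  have hP := fun d => isFinPart_ordPartition (X := X) hX hT.measurable d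
  have hTm := hT.toMeasurePreserving
  refine ⟨fun d => (subadditive_entH_ajoin (hP d) hTm).lim,
    fun d => tendsto_entH_ajoin_div (hP d) hTm, ?_⟩
  have hks : ∀ P : {P : Finset (Set Ω) // IsFinPart P},
      atTop.liminf (fun k : ℕ => entH μ (ajoin T P.1 k) / k) =
        (subadditive_entH_ajoin P.2 hTm).lim :=
    fun P => (tendsto_entH_ajoin_div P.2 hTm).liminf_eq
  refine tendsto_order.2 ⟨fun c hc => ?_, fun c hc => Eventually.of_forall fun d => ?_⟩
  · obtain ⟨⟨Q, hQ⟩, hcQ⟩ := lt_iSup_iff.1 hc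
    rw [hks ⟨Q, hQ⟩] at hcQ
    have hc_top : c ≠ ⊤ := hcQ.ne_top
    have hcQ' := (ENNReal.lt_ofReal_iff_toReal_lt hc_top).1 hcQ
    filter_upwards [eventually_entropyRate_le hP hQ hTm
      (fun A hA => approximable_of_generating hT hX hgen₁ (hQ.1 A hA))
      (half_pos (sub_pos.2 hcQ'))] with d hd
    exact (ENNReal.lt_ofReal_iff_toReal_lt hc_top).2 (by linarith)
  · refine lt_of_le_of_lt ?_ hc
    change ENNReal.ofReal (subadditive_entH_ajoin (hP d) hTm).lim ≤ _
    rw [← show _ = (subadditive_entH_ajoin (hP d) hTm).lim from hks ⟨_, hP d⟩]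
    exact le_iSup (fun P : {P : Finset (Set Ω) // IsFinPart P} =>
      ENNReal.ofReal (atTop.liminf fun k : ℕ => entH μ (ajoin T P.1 k) / k)) ⟨_, hP d⟩
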